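/- arXiv:1410.2882 — 4 statements merged into one kernel-verified Lean document; each statement's English description precedes it below -/
import Mathlib

section
/- Let d ≥ 1 and let x ∈ ℝ^d be a vector with all coordinates nonnegative. Then there exists a nonempty subset S ⊆ {1, …, d} such that (1/√|S|) · ∑_{j ∈ S} x_j ≥ ‖x‖₂ / (2 · √(log₂(d) + 3)). -/
open scoped BigOperators

/-- **Geometric Lemma** (nonnegative real version): for any `x ∈ ℝ^d` with nonnegative
coordinates there is a nonempty subset `S ⊆ [d]` with
`(1/√|S|)·∑_{j∈S} x_j ≥ ‖x‖₂ / (2·√(log₂ d + 3))`. -/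
theorem geometric_lemma_nonneg (d : ℕ) (hd : 1 ≤ d) (x : Fin d → ℝ)
    (hx : ∀ j, 0 ≤ x j) :
    ∃ S : Finset (Fin d), S.Nonempty ∧
      (1 / Real.sqrt S.card) * ∑ j ∈ S, x j ≥
        Real.sqrt (∑ j, x j ^ 2) / (2 * Real.sqrt (Real.logb 2 d + 3)) := by
  by_contra! hcon
  have hd1 : (1 : ℝ) ≤ d := by exact_mod_cast hd
  have hlog0 : 0 ≤ Real.log d := Real.log_nonneg hd1
  have hlog : Real.log d ≤ Real.logb 2 d := by
    have h2 : Real.log 2 < 1 := by linarith [Real.log_two_lt_d9]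
    have h20 : 0 < Real.log 2 := Real.log_pos (by norm_num)
    rw [Real.logb, le_div_iff₀ h20]
    nlinarith
  set A := ∑ j, x j ^ 2 with hA
  set L := Real.logb 2 d with hL
  set C := Real.sqrt A / (2 * Real.sqrt (L + 3)) with hC
  have hA0 : 0 ≤ A := Finset.sum_nonneg fun j _ => sq_nonneg _
  have hC2 : C ^ 2 * (4 * (L + 3)) = A := by
    have hL3 : 0 < L + 3 := by linarith
    rw [hC, div_pow, mul_pow, Real.sq_sqrt hA0, Real.sq_sqrt hL3.le]
    field_simp
    norm_num
  have hCpos : 0 < C := by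
    have h := hcon {⟨0, hd⟩} (Finset.singleton_nonempty _)
    simp at h
    exact (hx _).trans_lt h
  let σ := Tuple.sort (fun j => - x j)
  have hmono : ∀ i k : Fin d, i ≤ k → x (σ k) ≤ x (σ i) := by
    intro i k hik
    have := Tuple.monotone_sort (fun j => - x j) hik
    simp only [Function.comp] at this
    exact neg_le_neg_iff.mp this
  have hkey : ∀ k : Fin d, x (σ k) ^ 2 ≤ C ^ 2 * ((k : ℝ) + 1)⁻¹ := by
    intro k
    have h := hcon ((Finset.Iic k).map σ.toEmbedding) (by simp)
    rw [Finset.card_map, Fin.card_Iic, Finset.sum_map] at h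
    have hs : ((k : ℝ) + 1) * x (σ k) ≤ ∑ i ∈ Finset.Iic k, x (σ.toEmbedding i) := by
      have := Finset.card_nsmul_le_sum (Finset.Iic k) (fun i => x (σ.toEmbedding i)) (x (σ k))
        (fun i hi => hmono i k (Finset.mem_Iic.mp hi))
      rw [Fin.card_Iic, nsmul_eq_mul] at this
      push_cast at this
      exact this
    push_cast at h
    have hk : (0 : ℝ) < (k : ℝ) + 1 := by positivity
    have hq := Real.sqrt_pos.mpr hk
    have hq2 := Real.sq_sqrt hk.le
    rw [one_div, inv_mul_lt_iff₀ hq] at h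
    rw [← div_eq_mul_inv, le_div_iff₀ hk]
    have h3 : Real.sqrt ((k : ℝ) + 1) * x (σ k) ≤ C := by
      have : Real.sqrt ((k : ℝ) + 1) * (Real.sqrt ((k : ℝ) + 1) * x (σ k))
          ≤ Real.sqrt ((k : ℝ) + 1) * C := by
        rw [← mul_assoc, ← sq, hq2]; linarith
      exact le_of_mul_le_mul_left this hq
    have h4 := pow_le_pow_left₀ (mul_nonneg hq.le (hx (σ k))) h3 2
    rw [mul_pow, hq2] at h4
    linarith
  have hsum : A ≤ C ^ 2 * (1 + Real.log d) := by
    have e : A = ∑ k, x (σ k) ^ 2 := (Equiv.sum_comp σ (fun j => x j ^ 2)).symm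
    have hh := harmonic_le_one_add_log d
    have e2 : ((harmonic d : ℚ) : ℝ) = ∑ k : Fin d, ((k : ℝ) + 1)⁻¹ := by
      rw [Fin.sum_univ_eq_sum_range (fun k => ((k : ℝ) + 1)⁻¹) d, harmonic]
      push_cast
      rfl
    calc A = ∑ k, x (σ k) ^ 2 := e
      _ ≤ ∑ k : Fin d, C ^ 2 * ((k : ℝ) + 1)⁻¹ := Finset.sum_le_sum fun k _ => hkey k
      _ = C ^ 2 * (harmonic d : ℚ) := by rw [e2, Finset.mul_sum]
      _ ≤ _ := by gcongr
  have : C ^ 2 * (1 + Real.log d) < C ^ 2 * (4 * (L + 3)) := by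
    apply mul_lt_mul_of_pos_left _ (by positivity)
    linarith
  linarith
end

section
/- Let d ≥ 1, let x ∈ ℝ^d be a nonzero vector with all coordinates nonnegative, and set γ := ⌈(log₂(d) + 1)/2⌉. For k ∈ {1, …, γ} define T_k := { j : ‖x‖₂/2^k < x_j ≤ ‖x‖₂/2^{k−1} }. Then there exists k' ∈ {1, …, γ} such that ∑_{j ∈ T_{k'}} x_j² ≥ (‖x‖₂²/γ) · (1 − d/2^{2γ}). -/
open scoped BigOperators

/-- Dyadic level-set lemma: for nonzero `x ∈ ℝ^d` with nonnegative coordinates and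
`γ := ⌈(log₂ d + 1)/2⌉`, with `T_k := {j : ‖x‖₂/2^k < x_j ≤ ‖x‖₂/2^(k-1)}`, some level
`k' ∈ {1, …, γ}` satisfies `∑_{j ∈ T_{k'}} x_j² ≥ (‖x‖₂²/γ)·(1 − d/2^(2γ))`. -/
theorem dyadic_level_set (d : ℕ) (hd : 1 ≤ d) (x : Fin d → ℝ)
    (hnn : ∀ j, 0 ≤ x j) (hx : x ≠ 0)
    (γ : ℕ) (hγ : γ = ⌈(Real.logb 2 d + 1) / 2⌉₊) :
    ∃ k' ∈ Finset.Icc 1 γ,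
      (∑ j ∈ Finset.univ.filter (fun j : Fin d =>
          Real.sqrt (∑ i, x i ^ 2) / 2 ^ k' < x j ∧
          x j ≤ Real.sqrt (∑ i, x i ^ 2) / 2 ^ (k' - 1)), x j ^ 2) ≥
        (∑ i, x i ^ 2) / γ * (1 - d / 2 ^ (2 * γ)) := by
  classical
  have hγ1 : 1 ≤ γ := by
    rw [hγ]
    apply Nat.one_le_iff_ne_zero.mpr
    have : 0 ≤ Real.logb 2 d := Real.logb_nonneg (by norm_num) (by exact_mod_cast hd)
    exact (Nat.ceil_pos.mpr (by linarith)).ne'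
  have hγ0 : (0 : ℝ) < γ := by exact_mod_cast hγ1
  set S : ℝ := ∑ i, x i ^ 2 with hS
  have hS0 : 0 ≤ S := Finset.sum_nonneg (fun i _ => sq_nonneg _)
  have hle : ∀ j, x j ≤ Real.sqrt S := fun j =>
    Real.le_sqrt_of_sq_le
      (Finset.single_le_sum (f := fun i => x i ^ 2) (fun i _ => sq_nonneg _) (Finset.mem_univ j))
  have key : ∀ j, x j ^ 2 ≤ (∑ k ∈ Finset.Icc 1 γ,
      if Real.sqrt S / 2 ^ k < x j ∧ x j ≤ Real.sqrt S / 2 ^ (k - 1) then x j ^ 2 else 0)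
      + S / 2 ^ (2 * γ) := by
    intro j
    have hnon : ∀ k ∈ Finset.Icc 1 γ, (0 : ℝ) ≤
        if Real.sqrt S / 2 ^ k < x j ∧ x j ≤ Real.sqrt S / 2 ^ (k - 1) then x j ^ 2 else 0 := by
      intro k _
      split_ifs <;> positivity
    have hp : 0 ≤ S / 2 ^ (2 * γ) := by positivity
    by_cases h : x j ≤ Real.sqrt S / 2 ^ γ
    · have h1 : x j ^ 2 ≤ (Real.sqrt S / 2 ^ γ) ^ 2 := pow_le_pow_left₀ (hnn j) h 2
      rw [div_pow, Real.sq_sqrt hS0, ← pow_mul, mul_comm γ 2] at h1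
      have := Finset.sum_nonneg hnon
      linarith
    · push Not at h
      have hex : ∃ k, Real.sqrt S / 2 ^ k < x j := ⟨γ, h⟩
      have hk := Nat.find_spec hex
      have hkγ : Nat.find hex ≤ γ := Nat.find_min' hex h
      have hk1 : 1 ≤ Nat.find hex := by
        rw [Nat.one_le_iff_ne_zero]
        intro h0
        rw [h0] at hk
        have := hle j
        simp at hk
        linarith
      have hk2 := Nat.find_min hex (m := Nat.find hex - 1) (by omega)
      have := Finset.single_le_sum hnon (Finset.mem_Icc.mpr ⟨hk1, hkγ⟩)
      rw [if_pos ⟨hk, not_lt.mp hk2⟩] at this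
      linarith
  by_contra! hcon
  have h1 := Finset.sum_lt_sum_of_nonempty (Finset.nonempty_Icc.mpr hγ1) hcon
  have h2 := Finset.sum_le_sum (fun j (_ : j ∈ Finset.univ) => key j)
  rw [Finset.sum_add_distrib, Finset.sum_comm] at h2
  simp only [← Finset.sum_filter] at h2
  simp only [Finset.sum_const, Finset.card_univ, Fintype.card_fin, Nat.card_Icc, nsmul_eq_mul,
    Nat.add_sub_cancel] at h1 h2
  have h3 : (γ : ℝ) * (S / γ * (1 - d / 2 ^ (2 * γ))) = S - d * (S / 2 ^ (2 * γ)) := by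
    field_simp
  rw [h3] at h1
  linarith
end

section
/- For every n ≥ 1, define the unit vector ψ_n ∈ ℂ^{2^n} whose i-th coordinate is 1/(√n · √(2^{⌊log₂ i⌋})) for 1 ≤ i ≤ 2^n − 1 and whose 2^n-th coordinate is 0. Then for every nonempty subset S ⊆ {1, …, 2^n}, the inner product satisfies ⟨ψ_n, S⟩ ≤ (2 + √2)/√n. -/
open scoped BigOperators

/-- The subset state (as a real vector) for a subset `S ⊆ [d]`: coordinate `1/√|S|` on
`S`, and `0` elsewhere. -/
noncomputable def subsetStateR {d : ℕ} (S : Finset (Fin d)) : Fin d → ℝ :=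
  fun i => if i ∈ S then 1 / Real.sqrt S.card else 0

lemma aux_sum (T : Finset ℕ) :
    ∑ i ∈ T, 1 / Real.sqrt (2 ^ Nat.log 2 (i + 1)) ≤ 2 * Real.sqrt 2 * Real.sqrt T.card := by
  induction T using Finset.induction_on_max with
  | empty => simp
  | insert a s hs ih =>
    have hn : a ∉ s := fun h => lt_irrefl _ (hs a h)
    rw [Finset.sum_insert hn, Finset.card_insert_of_notMem hn]
    have hc : s.card ≤ a := by
      have : s ⊆ Finset.range a := fun x hx => Finset.mem_range.2 (hs x hx)
      simpa using Finset.card_le_card this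
    have h1 : a + 1 < 2 ^ (Nat.log 2 (a + 1) + 1) := Nat.lt_pow_succ_log_self (by norm_num) _
    have h2 : ((s.card : ℝ) + 1) ≤ 2 * 2 ^ Nat.log 2 (a + 1) := by
      have : s.card + 1 ≤ 2 * 2 ^ Nat.log 2 (a + 1) := by rw [pow_succ] at h1; omega
      exact_mod_cast this
    have h3 : Real.sqrt (s.card + 1) ≤ Real.sqrt 2 * Real.sqrt (2 ^ Nat.log 2 (a + 1)) := by
      rw [← Real.sqrt_mul (by norm_num)]
      exact Real.sqrt_le_sqrt h2
    have hp : 0 < Real.sqrt (2 ^ Nat.log 2 (a + 1)) := by positivity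
    have hq : 0 < Real.sqrt ((s.card : ℝ) + 1) := by positivity
    have hu : Real.sqrt ((s.card : ℝ) + 1) ^ 2 = s.card + 1 := Real.sq_sqrt (by positivity)
    have hv : Real.sqrt (s.card : ℝ) ^ 2 = s.card := Real.sq_sqrt (by positivity)
    have h4 : 1 / Real.sqrt (2 ^ Nat.log 2 (a + 1)) ≤ Real.sqrt 2 * (1 / Real.sqrt (s.card + 1)) := by
      rw [mul_one_div, div_le_div_iff₀ hp hq]
      linarith
    have h5 : 1 / Real.sqrt ((s.card : ℝ) + 1)
        ≤ 2 * (Real.sqrt (s.card + 1) - Real.sqrt s.card) := by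
      rw [div_le_iff₀ hq]
      nlinarith [sq_nonneg (Real.sqrt ((s.card : ℝ) + 1) - Real.sqrt s.card)]
    have h6 := mul_le_mul_of_nonneg_left h5 (Real.sqrt_nonneg 2)
    push_cast
    linarith

/-- Tightness of the Subset State Approximation Lemma: the state `ψ_n` whose `i`-th
coordinate (for `1 ≤ i ≤ 2^n - 1`, here indexed by `i - 1 : Fin (2^n)`) is
`1/(√n·√(2^⌊log₂ i⌋))`, and whose `2^n`-th coordinate is `0`, has overlap at most
`(2 + √2)/√n` with every subset state. -/
theorem subset_state_approximation_tight (n : ℕ) (hn : 1 ≤ n)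
    (ψ : Fin (2 ^ n) → ℝ)
    (hψ : ∀ i : Fin (2 ^ n), ψ i =
        if (i : ℕ) + 1 = 2 ^ n then 0
        else 1 / (Real.sqrt n * Real.sqrt (2 ^ Nat.log 2 ((i : ℕ) + 1))))
    (S : Finset (Fin (2 ^ n))) (hS : S.Nonempty) :
    ∑ i, ψ i * subsetStateR S i ≤ (2 + Real.sqrt 2) / Real.sqrt n := by
  have hc : 0 < Real.sqrt (S.card : ℝ) := Real.sqrt_pos.2 (by exact_mod_cast hS.card_pos)
  have hn' : 0 < Real.sqrt (n : ℝ) := Real.sqrt_pos.2 (by exact_mod_cast hn)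
  have key := aux_sum (S.map Fin.valEmbedding)
  rw [Finset.sum_map, Finset.card_map] at key
  simp only [Fin.valEmbedding_apply] at key
  have h1 : ∑ i, ψ i * subsetStateR S i = (∑ i ∈ S, ψ i) / Real.sqrt S.card := by
    simp [subsetStateR, Finset.sum_div, div_eq_mul_inv, Finset.sum_mul]
  have h2 : ∑ i ∈ S, ψ i
      ≤ (∑ i ∈ S, 1 / Real.sqrt (2 ^ Nat.log 2 ((i : ℕ) + 1))) / Real.sqrt n := by
    rw [Finset.sum_div]
    apply Finset.sum_le_sum
    intro i _
    rw [hψ]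
    split_ifs
    · positivity
    · rw [div_div, mul_comm]
  have h3 : Real.sqrt 2 ≤ 2 := by
    rw [Real.sqrt_le_left (by norm_num)]; norm_num
  rw [h1, div_le_iff₀ hc]
  refine h2.trans ?_
  rw [div_mul_eq_mul_div]
  apply div_le_div_of_nonneg_right _ hn'.le
  refine key.trans ?_
  apply mul_le_mul_of_nonneg_right _ hc.le
  linarith
end

section
/- For every n ≥ 1 and every m with 1 ≤ m ≤ 2^n − 1, one has (1/√m) · ∑_{i=1}^{m} 1/√(2^{⌊log₂ i⌋}) ≤ 2 + √2. -/
open scoped BigOperators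

lemma term_bound (i : ℕ) (hi : 1 ≤ i) :
    1 / Real.sqrt (2 ^ Nat.log 2 i) ≤ Real.sqrt 2 / Real.sqrt i := by
  have h : i < 2 ^ (Nat.log 2 i + 1) := Nat.lt_pow_succ_log_self (by norm_num) i
  have h' : (i : ℝ) ≤ 2 * 2 ^ Nat.log 2 i := by
    have : (i : ℝ) < 2 ^ (Nat.log 2 i + 1) := by exact_mod_cast h
    rw [pow_succ] at this
    linarith
  have hi' : (0 : ℝ) < i := by exact_mod_cast hi
  rw [div_le_div_iff₀ (Real.sqrt_pos.2 (by positivity)) (Real.sqrt_pos.2 hi'), one_mul,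
    ← Real.sqrt_mul (by norm_num)]
  exact Real.sqrt_le_sqrt h'

lemma sum_bound (m : ℕ) :
    ∑ i ∈ Finset.Icc 1 m, 1 / Real.sqrt (2 ^ Nat.log 2 i) ≤
      2 * Real.sqrt 2 * Real.sqrt m := by
  induction m with
  | zero => simp
  | succ k ih =>
    rw [Finset.sum_Icc_succ_top (by omega)]
    have ht := term_bound (k + 1) (by omega)
    have hb : 0 < Real.sqrt ((k + 1 : ℕ) : ℝ) := Real.sqrt_pos.2 (by positivity)
    have hb2 : Real.sqrt ((k + 1 : ℕ) : ℝ) ^ 2 = k + 1 := by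
      rw [Real.sq_sqrt (by positivity)]; push_cast; ring
    have ha2 : Real.sqrt (k : ℝ) ^ 2 = k := Real.sq_sqrt (by positivity)
    have hs : 0 ≤ Real.sqrt 2 := Real.sqrt_nonneg 2
    generalize Real.sqrt ((k + 1 : ℕ) : ℝ) = b at *
    generalize Real.sqrt (k : ℝ) = a at *
    have h1 : 1 / b ≤ 2 * (b - a) := by
      rw [div_le_iff₀ hb]
      nlinarith [sq_nonneg (b - a)]
    have h2 : Real.sqrt 2 / b ≤ Real.sqrt 2 * (2 * (b - a)) := by
      rw [div_eq_mul_one_div]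
      exact mul_le_mul_of_nonneg_left h1 hs
    linarith

/-- For every `n ≥ 1` and `1 ≤ m ≤ 2^n - 1`, the initial-segment overlap satisfies
`(1/√m)·∑_{i=1}^m 1/√(2^⌊log₂ i⌋) ≤ 2 + √2`. -/
theorem initial_segment_bound (n m : ℕ) (hn : 1 ≤ n) (hm1 : 1 ≤ m) (hm2 : m ≤ 2 ^ n - 1) :
    (1 / Real.sqrt m) * ∑ i ∈ Finset.Icc 1 m, 1 / Real.sqrt (2 ^ Nat.log 2 i) ≤
      2 + Real.sqrt 2 := by
  have h := sum_bound m
  have hm : 0 < Real.sqrt (m : ℝ) := Real.sqrt_pos.2 (by exact_mod_cast hm1)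
  have h2 : Real.sqrt 2 ≤ 2 := by
    rw [Real.sqrt_le_left (by norm_num)]; norm_num
  rw [one_div_mul_eq_div, div_le_iff₀ hm]
  refine h.trans (mul_le_mul_of_nonneg_right ?_ hm.le)
  linarith
end
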